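/- Let π be a set of primes and G = AB a finite group that is the product of subgroups A and B, with A₀ ⊴ A and B₀ ⊴ B normal π-subgroups such that A₀B₀ = B₀A₀. If O_π(G) = 1, then the normal closures A₀^G and B₀^G commute elementwise: [A₀^G, B₀^G] = 1. -/

import Mathlib

open scoped Pointwise

namespace PiAux

set_option linter.unusedSectionVars false

variable {G : Type*} [Group G] [Finite G]

/-- The order of `H` has all prime divisors in `π`. -/
def IsPi (π : Set ℕ) (H : Subgroup G) : Prop := ∀ p ∈ (Nat.card H).primeFactors, p ∈ π

lemma IsPi.mono {π : Set ℕ} {H K : Subgroup G} (hK : IsPi π K) (h : H ≤ K) : IsPi π H := by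
  intro p hp
  exact hK p (Nat.primeFactors_mono (Subgroup.card_dvd_of_le h) Nat.card_pos.ne' hp)

lemma card_mul_dvd (H K : Subgroup G) :
    Nat.card ((H : Set G) * (K : Set G) : Set G) ∣ Nat.card H * Nat.card K := by
  rw [Subgroup.card_mul_eq_card_subgroup_mul_card_quotient, mul_comm]
  apply mul_dvd_mul_right
  have h : ((H : Set G).image (fun x : G => (x : G ⧸ K)))
      = MulAction.orbit H ((1 : G) : G ⧸ K) := by
    ext q
    constructor
    · rintro ⟨x, hx, rfl⟩
      refine ⟨⟨x, hx⟩, ?_⟩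
      change ((x * 1 : G) : G ⧸ K) = _
      rw [mul_one]
    · rintro ⟨⟨x, hx⟩, rfl⟩
      refine ⟨x, hx, ?_⟩
      change _ = ((x * 1 : G) : G ⧸ K)
      rw [mul_one]
  rw [h, Nat.card_coe_set_eq, ← MulAction.index_stabilizer]
  exact Subgroup.index_dvd_card _

lemma IsPi.sup {π : Set ℕ} {H K : Subgroup G} (hH : IsPi π H) (hK : IsPi π K)
    (hp : ∀ x ∈ H, ∀ y ∈ K, ∃ y' ∈ K, ∃ x' ∈ H, x * y = y' * x') : IsPi π (H ⊔ K) := by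
  have hp' : ∀ x ∈ H, ∀ y ∈ K, ∃ x' ∈ H, ∃ y' ∈ K, y * x = x' * y' := by
    intro x hx y hy
    obtain ⟨y', hy', x', hx', h⟩ := hp x⁻¹ (inv_mem hx) y⁻¹ (inv_mem hy)
    refine ⟨x'⁻¹, inv_mem hx', y'⁻¹, inv_mem hy', ?_⟩
    rw [← mul_inv_rev, ← h]; group
  have hs : ((H ⊔ K : Subgroup G) : Set G) = (H : Set G) * (K : Set G) := by
    apply Set.Subset.antisymm
    · let S : Subgroup G :=
        { carrier := (H : Set G) * (K : Set G)
          one_mem' := ⟨1, one_mem H, 1, one_mem K, by simp⟩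
          mul_mem' := by
            rintro _ _ ⟨a, ha, b, hb, rfl⟩ ⟨c, hc, d, hd, rfl⟩
            obtain ⟨x', hx', y', hy', h⟩ := hp' c hc b hb
            refine ⟨a * x', mul_mem ha hx', y' * d, mul_mem hy' hd, ?_⟩
            calc a * x' * (y' * d) = a * (x' * y') * d := by group
              _ = a * b * (c * d) := by rw [← h]; group
          inv_mem' := by
            rintro _ ⟨a, ha, b, hb, rfl⟩
            obtain ⟨x', hx', y', hy', h⟩ := hp' a⁻¹ (inv_mem ha) b⁻¹ (inv_mem hb)
            exact ⟨x', hx', y', hy', by simp [← h]⟩ }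
      have : H ⊔ K ≤ S := sup_le (fun x hx => ⟨x, hx, 1, one_mem K, by simp⟩)
        (fun x hx => ⟨1, one_mem H, x, hx, by simp⟩)
      exact this
    · rintro _ ⟨a, ha, b, hb, rfl⟩
      exact Subgroup.mul_mem_sup ha hb
  intro p hpp
  have hd : Nat.card (H ⊔ K : Subgroup G) ∣ Nat.card H * Nat.card K := by
    have := card_mul_dvd H K
    rw [← hs] at this
    exact this
  have := Nat.primeFactors_mono hd (mul_ne_zero Nat.card_pos.ne' Nat.card_pos.ne') hpp
  rw [Nat.primeFactors_mul Nat.card_pos.ne' Nat.card_pos.ne', Finset.mem_union] at this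
  exact this.elim (hH p) (hK p)

/-- The conjugate `g H g⁻¹`. -/
def cj (g : G) (H : Subgroup G) : Subgroup G := H.map (MulAut.conj g).toMonoidHom

lemma mem_cj {g x : G} {H : Subgroup G} : x ∈ cj g H ↔ g⁻¹ * x * g ∈ H := by
  constructor
  · rintro ⟨y, hy, rfl⟩
    have : g⁻¹ * ((MulAut.conj g).toMonoidHom y) * g = y := by simp [mul_assoc]
    rw [this]; exact hy
  · intro h
    exact ⟨_, h, by simp [mul_assoc]⟩

lemma IsPi.cj {π : Set ℕ} {H : Subgroup G} (hH : IsPi π H) (g : G) : IsPi π (cj g H) := by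
  unfold IsPi PiAux.cj
  rw [Subgroup.card_map_of_injective (MulAut.conj g).injective]
  exact hH

/-- A maximal subgroup with a property. -/
lemma exists_max (P : Subgroup G → Prop) (X₀ : Subgroup G) (h : P X₀) :
    ∃ X, P X ∧ ∀ Y, P Y → X ≤ Y → Y = X := by
  obtain ⟨X, hX, hm⟩ := (Set.toFinite {X | P X}).exists_maximal ⟨X₀, h⟩
  exact ⟨X, hX, fun Y hY hle => le_antisymm (hm hY hle) hle⟩

/-- A `π`-subgroup of a normal subgroup `M`, normalized by `M`, is trivial when `O_π(G) = 1`. -/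
lemma subnormal_trivial {π : Set ℕ} (M : Subgroup G) [M.Normal]
    (hO : ∀ K : Subgroup G, K.Normal → IsPi π K → K = ⊥)
    (L : Subgroup G) (hLM : L ≤ M) (hLn : ∀ m ∈ M, ∀ x ∈ L, m * x * m⁻¹ ∈ L)
    (hL : IsPi π L) : L = ⊥ := by
  let P : Subgroup G → Prop := fun X => X ≤ M ∧ (∀ m ∈ M, ∀ x ∈ X, m * x * m⁻¹ ∈ X) ∧ IsPi π X
  obtain ⟨K, ⟨hKM, hKn, hKπ⟩, hmax⟩ := exists_max P L ⟨hLM, hLn, hL⟩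
  have key : ∀ X, P X → X ≤ K := by
    rintro X ⟨hXM, hXn, hXπ⟩
    have : K ⊔ X = K := by
      apply hmax _ _ le_sup_left
      refine ⟨sup_le hKM hXM, ?_, ?_⟩
      · intro m hm
        have : K ⊔ X ≤ (K ⊔ X).comap (MulAut.conj m).toMonoidHom :=
          sup_le (fun x hx => (le_sup_left : K ≤ K ⊔ X) (hKn m hm x hx))
            (fun x hx => (le_sup_right : X ≤ K ⊔ X) (hXn m hm x hx))
        exact fun x hx => this hx
      · apply hKπ.sup hXπ
        intro x hx y hy
        exact ⟨x * y * x⁻¹, hXn x (hKM hx) y hy, x, hx, by group⟩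
    exact sup_eq_left.mp this
  have hK : K = ⊥ := by
    apply hO K _ hKπ
    refine ⟨fun x hx g => ?_⟩
    apply key (cj g K)
    · refine ⟨?_, ?_, hKπ.cj g⟩
      · intro z hz
        have := Subgroup.Normal.conj_mem ‹M.Normal› _ (hKM (mem_cj.mp hz)) g
        convert this using 1; group
      · intro m hm z hz
        rw [mem_cj] at hz ⊢
        have hm' : g⁻¹ * m * g ∈ M := by
          simpa using Subgroup.Normal.conj_mem ‹M.Normal› m hm g⁻¹
        convert hKn _ hm' _ hz using 1; group
    · rw [mem_cj]; convert hx using 1; group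
  exact le_bot_iff.mp (hK ▸ key L ⟨hLM, hLn, hL⟩)

/-- `X` permutes with every conjugate of `B`. -/
def PermAll (X B : Subgroup G) : Prop :=
  ∀ g : G, ∀ x ∈ X, ∀ y ∈ cj g B, ∃ y' ∈ cj g B, ∃ x' ∈ X, x * y = y' * x'

lemma PermAll.cj {X B : Subgroup G} (h : PermAll X B) (c : G) : PermAll (cj c X) B := by
  intro g x hx y hy
  rw [mem_cj] at hx hy
  obtain ⟨y', hy', x', hx', he⟩ := h (c⁻¹ * g) _ hx (c⁻¹ * y * c)
    (by rw [mem_cj]; convert hy using 1; group)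
  rw [mem_cj] at hy'
  refine ⟨c * y' * c⁻¹, ?_, c * x' * c⁻¹, ?_, ?_⟩
  · rw [mem_cj]; convert hy' using 1; group
  · rw [mem_cj]; convert hx' using 1; group
  · calc x * y = c * ((c⁻¹ * x * c) * (c⁻¹ * y * c)) * c⁻¹ := by group
      _ = _ := by rw [he]; group

lemma PermAll.sup {X Y B : Subgroup G} (hX : PermAll X B) (hY : PermAll Y B) :
    PermAll (X ⊔ Y) B := by
  intro g x hx
  rw [Subgroup.sup_eq_closure] at hx
  have step : ∀ z ∈ (X : Set G) ∪ Y, ∀ y ∈ PiAux.cj g B, ∃ y' ∈ PiAux.cj g B,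
      ∃ x' ∈ X ⊔ Y, z * y = y' * x' := by
    rintro z (hz | hz) y hy
    · obtain ⟨y', hy', x', hx', he⟩ := hX g z hz y hy
      exact ⟨y', hy', x', (le_sup_left : X ≤ X ⊔ Y) hx', he⟩
    · obtain ⟨y', hy', x', hx', he⟩ := hY g z hz y hy
      exact ⟨y', hy', x', (le_sup_right : Y ≤ X ⊔ Y) hx', he⟩
  have comb : ∀ z w : G, (∀ y ∈ PiAux.cj g B, ∃ y' ∈ PiAux.cj g B, ∃ x' ∈ X ⊔ Y, z * y = y' * x') →
      (∀ y ∈ PiAux.cj g B, ∃ y' ∈ PiAux.cj g B, ∃ x' ∈ X ⊔ Y, w * y = y' * x') →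
      (∀ y ∈ PiAux.cj g B, ∃ y' ∈ PiAux.cj g B, ∃ x' ∈ X ⊔ Y, z * w * y = y' * x') := by
    intro z w hz hw y hy
    obtain ⟨y', hy', x', hx', he⟩ := hw y hy
    obtain ⟨y'', hy'', x'', hx'', he'⟩ := hz y' hy'
    refine ⟨y'', hy'', x'' * x', mul_mem hx'' hx', ?_⟩
    rw [mul_assoc, he, ← mul_assoc, he', mul_assoc]
  induction hx using Subgroup.closure_induction'' with
  | mem z hz => exact step z hz
  | inv_mem z hz =>
    apply step
    exact hz.imp (fun h => X.inv_mem h) (fun h => Y.inv_mem h)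
  | one => exact fun y hy => ⟨y, hy, 1, one_mem _, by simp⟩
  | mul z w _ _ hz hw => exact comb z w hz hw

lemma main {π : Set ℕ} (A B : Subgroup G) (hA : IsPi π A) (hB : IsPi π B) (hp : PermAll A B)
    (hO : ∀ K : Subgroup G, K.Normal → IsPi π K → K = ⊥) :
    ∀ x ∈ A, ∀ m ∈ Subgroup.normalClosure (B : Set G), m * x = x * m := by
  obtain ⟨X, ⟨hAX, hXπ, hXp⟩, hmax⟩ :=
    exists_max (fun X => A ≤ X ∧ IsPi π X ∧ PermAll X B) A ⟨le_rfl, hA, hp⟩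
  have h1 : ∀ g, ∀ b ∈ cj g B, cj b X ≤ X := by
    intro g b hb
    have : X ⊔ cj b X = X := by
      apply hmax _ _ le_sup_left
      refine ⟨hAX.trans le_sup_left, ?_, hXp.sup (hXp.cj b)⟩
      apply (hXπ.sup (hB.cj g) (hXp g)).mono
      refine sup_le le_sup_left ?_
      intro z hz
      rw [mem_cj] at hz
      have hb' : b ∈ X ⊔ cj g B := (le_sup_right : cj g B ≤ X ⊔ cj g B) hb
      have := mul_mem (mul_mem hb' ((le_sup_left : X ≤ X ⊔ cj g B) hz)) (inv_mem hb')
      convert this using 1; group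
    exact sup_eq_left.mp this
  set M := Subgroup.normalClosure (B : Set G) with hM
  have h2 : ∀ m ∈ M, ∀ x ∈ X, m * x * m⁻¹ ∈ X := by
    intro m hm
    have hc : ∀ z ∈ Group.conjugatesOfSet (B : Set G), ∃ g, z ∈ cj g B := by
      intro z hz
      obtain ⟨b, hb, hbz⟩ := Group.mem_conjugatesOfSet_iff.mp hz
      obtain ⟨c, rfl⟩ := isConj_iff.mp hbz
      refine ⟨c, ?_⟩
      rw [mem_cj]
      have hb2 : b ∈ B := hb
      convert hb2 using 1; group
    have hn : ∀ g, ∀ z ∈ cj g B, ∀ x ∈ X, z * x * z⁻¹ ∈ X := by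
      intro g z hz x hx
      apply h1 g z hz
      rw [mem_cj]; convert hx using 1; group
    induction hm using Subgroup.closure_induction'' with
    | mem z hz => obtain ⟨g, hg⟩ := hc z hz; exact hn g z hg
    | inv_mem z hz => obtain ⟨g, hg⟩ := hc z hz; exact hn g z⁻¹ (inv_mem hg)
    | one => simp
    | mul z w _ _ hz hw =>
      intro x hx
      convert hz _ (hw x hx) using 1; group
  have h3 : X ⊓ M = ⊥ := by
    apply subnormal_trivial M hO _ inf_le_right _ (hXπ.mono inf_le_left)
    intro m hm x hx
    exact Subgroup.mem_inf.mpr ⟨h2 m hm x hx.1, M.mul_mem (M.mul_mem hm hx.2) (M.inv_mem hm)⟩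
  intro x hx m hm
  have h4 : m * x * m⁻¹ * x⁻¹ ∈ X ⊓ M := by
    refine Subgroup.mem_inf.mpr ⟨mul_mem (h2 m hm x (hAX hx)) (inv_mem (hAX hx)), ?_⟩
    have hMn : M.Normal := Subgroup.normalClosure_normal
    have := mul_mem hm (hMn.conj_mem _ (inv_mem hm) x)
    convert this using 1; group
  rw [h3, Subgroup.mem_bot] at h4
  rw [mul_inv_eq_one, mul_inv_eq_iff_eq_mul] at h4
  exact h4

end PiAux

theorem stmt_1 {G : Type*} [Group G] [Finite G] (π : Set ℕ) (A B A₀ B₀ : Subgroup G)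
    (hAB : (A : Set G) * (B : Set G) = Set.univ)
    (hA₀A : A₀ ≤ A) (hB₀B : B₀ ≤ B)
    (hA₀n : ∀ a ∈ A, ∀ x ∈ A₀, a * x * a⁻¹ ∈ A₀)
    (hB₀n : ∀ b ∈ B, ∀ x ∈ B₀, b * x * b⁻¹ ∈ B₀)
    (hA₀π : ∀ p ∈ (Nat.card A₀).primeFactors, p ∈ π)
    (hB₀π : ∀ p ∈ (Nat.card B₀).primeFactors, p ∈ π)
    (hperm : (A₀ : Set G) * (B₀ : Set G) = (B₀ : Set G) * (A₀ : Set G))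
    (hOπ : ∀ K : Subgroup G, K.Normal →
      (∀ p ∈ (Nat.card K).primeFactors, p ∈ π) → K = ⊥) :
    ∀ x ∈ Subgroup.normalClosure (A₀ : Set G),
      ∀ y ∈ Subgroup.normalClosure (B₀ : Set G), x * y = y * x := by
  have hp : PiAux.PermAll A₀ B₀ := by
    intro g x hx y hy
    rw [PiAux.mem_cj] at hy
    obtain ⟨a, ha, b, hb, hg⟩ : g ∈ (A : Set G) * (B : Set G) := hAB ▸ Set.mem_univ g
    change a * b = g at hg
    subst hg
    have hx' : a⁻¹ * x * a ∈ A₀ := by simpa using hA₀n a⁻¹ (inv_mem ha) x hx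
    have hy' : a⁻¹ * y * a ∈ B₀ := by
      convert hB₀n b hb _ hy using 1; group
    have hm : (a⁻¹ * x * a) * (a⁻¹ * y * a) ∈ (B₀ : Set G) * (A₀ : Set G) :=
      hperm ▸ Set.mul_mem_mul hx' hy'
    obtain ⟨v, hv, u, hu, he⟩ := hm
    change v * u = _ at he
    refine ⟨a * v * a⁻¹, ?_, a * u * a⁻¹, hA₀n a ha u hu, ?_⟩
    · rw [PiAux.mem_cj]
      convert hB₀n b⁻¹ (inv_mem hb) v hv using 1; group
    · calc x * y = a * ((a⁻¹ * x * a) * (a⁻¹ * y * a)) * a⁻¹ := by group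
        _ = _ := by rw [← he]; group
  have key := PiAux.main A₀ B₀ hA₀π hB₀π hp hOπ
  intro x hx y hy
  have hle : Subgroup.normalClosure (A₀ : Set G) ≤
      Subgroup.centralizer (Subgroup.normalClosure (B₀ : Set G) : Set G) :=
    Subgroup.normalClosure_le_normal
      (fun x hx => Subgroup.mem_centralizer_iff.mpr (fun m hm => key x hx m hm))
  exact (Subgroup.mem_centralizer_iff.mp (hle hx) y hy).symm
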